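/- arXiv:1201.2198 — 2 statements merged into one kernel-verified Lean document; each statement's English description precedes it below -/
import Mathlib

section
/- In the overlap array setup, suppose μ satisfies the Ghirlanda–Guerra identities for system 2. Then for every n ≥ 1 and all Borel sets A ⊆ [−1,1], A₁ ⊆ [0,1], A₂ ⊆ [0,1], one has μ(B_{n+1}) ≥ μ₂(A₂) · μ(C_n). -/
open MeasureTheory

namespace OverlapArray

/-- The space `([-1,1]^{ℕ×ℕ})³` of triples of overlap arrays
`((R¹_{l,l'}), (R²_{l,l'}), (R_{l,l'}))` (realized inside `(ℝ^{ℕ×ℕ})³`, the constraint that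
entries lie in `[-1,1]` being imposed almost surely). -/
abbrev OA : Type := (ℕ → ℕ → ℝ) × (ℕ → ℕ → ℝ) × (ℕ → ℕ → ℝ)

/-- The overlap array `(R¹_{l,l'})` of the first system. -/
def R1 (ω : OA) : ℕ → ℕ → ℝ := ω.1

/-- The overlap array `(R²_{l,l'})` of the second system. -/
def R2 (ω : OA) : ℕ → ℕ → ℝ := ω.2.1

/-- The array `(R_{l,l'})` of cross overlaps. -/
def R (ω : OA) : ℕ → ℕ → ℝ := ω.2.2

/-- Relabelling the replicas of the first system by `π` and of the second system by `π'`. -/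
def permMap (π π' : Equiv.Perm ℕ) (ω : OA) : OA :=
  (fun l l' => R1 ω (π l) (π l'), fun l l' => R2 ω (π' l) (π' l'),
   fun l l' => R ω (π l) (π' l'))

/-- The overlap array setup: `μ` is a probability measure on `OA` with entries a.s. in
`[-1,1]`, `R¹, R²` a.s. symmetric with unit diagonal, and `μ` invariant under finitely
supported permutations of the replicas of each system. -/
structure Setup (μ : Measure OA) : Prop where
  prob : IsProbabilityMeasure μ
  bounded : ∀ᵐ ω ∂μ, ∀ l l', |R1 ω l l'| ≤ 1 ∧ |R2 ω l l'| ≤ 1 ∧ |R ω l l'| ≤ 1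
  symm : ∀ᵐ ω ∂μ, ∀ l l', R1 ω l l' = R1 ω l' l ∧ R2 ω l l' = R2 ω l' l
  diag : ∀ᵐ ω ∂μ, ∀ l, R1 ω l l = 1 ∧ R2 ω l l = 1
  exch : ∀ π π' : Equiv.Perm ℕ, {x | π x ≠ x}.Finite → {x | π' x ≠ x}.Finite →
    μ.map (permMap π π') = μ

/-- Evaluation of a function `f` of the overlaps on the first `n` replicas. -/
def fRep (n : ℕ)
    (f : ((Fin n → Fin n → ℝ) × (Fin n → Fin n → ℝ) × (Fin n → Fin n → ℝ)) → ℝ)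
    (ω : OA) : ℝ :=
  f (fun l l' => R1 ω l.val l'.val, fun l l' => R2 ω l.val l'.val,
     fun l l' => R ω l.val l'.val)

/-- The Ghirlanda–Guerra identities for system 1: for every `n ≥ 1`, every bounded
measurable function `f` of the overlaps on `n` replicas and every bounded Borel even
`ψ : [-1,1] → ℝ`,
`E[f·ψ(R¹_{1,n+1})] = (1/n) E[f]·E[ψ(R¹_{1,2})] + (1/n) ∑_{l=2}^n E[f·ψ(R¹_{1,l})]`
(replicas are indexed from `0` here, so `R¹_{1,l}` is `R1 ω 0 (l-1)`). -/
def GG1 (μ : Measure OA) : Prop :=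
  ∀ n : ℕ, 1 ≤ n →
  ∀ f : ((Fin n → Fin n → ℝ) × (Fin n → Fin n → ℝ) × (Fin n → Fin n → ℝ)) → ℝ,
    Measurable f → (∃ C, ∀ v, |f v| ≤ C) →
  ∀ ψ : ℝ → ℝ, Measurable ψ → (∃ C, ∀ x, |ψ x| ≤ C) → (∀ x, ψ (-x) = ψ x) →
    ∫ ω, fRep n f ω * ψ (R1 ω 0 n) ∂μ
      = (1 / n) * (∫ ω, fRep n f ω ∂μ) * (∫ ω, ψ (R1 ω 0 1) ∂μ)
        + (1 / n) * ∑ l ∈ Finset.Ico 1 n, ∫ ω, fRep n f ω * ψ (R1 ω 0 l) ∂μ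

/-- The Ghirlanda–Guerra identities for system 2. -/
def GG2 (μ : Measure OA) : Prop :=
  ∀ n : ℕ, 1 ≤ n →
  ∀ f : ((Fin n → Fin n → ℝ) × (Fin n → Fin n → ℝ) × (Fin n → Fin n → ℝ)) → ℝ,
    Measurable f → (∃ C, ∀ v, |f v| ≤ C) →
  ∀ ψ : ℝ → ℝ, Measurable ψ → (∃ C, ∀ x, |ψ x| ≤ C) → (∀ x, ψ (-x) = ψ x) →
    ∫ ω, fRep n f ω * ψ (R2 ω 0 n) ∂μ
      = (1 / n) * (∫ ω, fRep n f ω ∂μ) * (∫ ω, ψ (R2 ω 0 1) ∂μ)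
        + (1 / n) * ∑ l ∈ Finset.Ico 1 n, ∫ ω, fRep n f ω * ψ (R2 ω 0 l) ∂μ

/-- The event `{R_{1,1} ∈ A}`. -/
def EA (A : Set ℝ) : Set OA := {ω | R ω 0 0 ∈ A}

/-- The event `{|R¹_{l,l'}| ∈ A₁ for all l ≠ l' ≤ n}` (with `0`-based replica indices). -/
def E1 (n : ℕ) (A1 : Set ℝ) : Set OA :=
  {ω | ∀ l l', l < n → l' < n → l ≠ l' → |R1 ω l l'| ∈ A1}

/-- The event `{|R²_{l,l'}| ∈ A₂ for all l ≠ l' ≤ n}` (with `0`-based replica indices). -/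
def E2 (n : ℕ) (A2 : Set ℝ) : Set OA :=
  {ω | ∀ l l', l < n → l' < n → l ≠ l' → |R2 ω l l'| ∈ A2}

/-- The event `B_n`. -/
def Bev (n : ℕ) (A A1 A2 : Set ℝ) : Set OA := EA A ∩ E1 n A1 ∩ E2 n A2

/-- The event `C_n`. -/
def Cev (n : ℕ) (A A1 A2 : Set ℝ) : Set OA := EA A ∩ E1 (n + 1) A1 ∩ E2 n A2

end OverlapArray

open OverlapArray

namespace OverlapArray

/-- The event `C_n` with the cross overlap constraint put on the pair `(0,k)`. -/
def Dev (n k : ℕ) (A A1 A2 : Set ℝ) : Set OA :=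
  {ω | R ω 0 k ∈ A} ∩ E1 (n + 1) A1 ∩ E2 n A2

/-- The event that the overlap `(k,m)` of system 2 is outside `A2`. -/
def Fev (k m : ℕ) (A2 : Set ℝ) : Set OA := {ω | |R2 ω k m| ∉ A2}

lemma meas_R1 (k l : ℕ) : Measurable (fun ω : OA => R1 ω k l) := by
  unfold R1; fun_prop

lemma meas_R2 (k l : ℕ) : Measurable (fun ω : OA => R2 ω k l) := by
  unfold R2; fun_prop

lemma meas_R (k l : ℕ) : Measurable (fun ω : OA => R ω k l) := by
  unfold R; fun_prop

lemma meas_perm (π π' : Equiv.Perm ℕ) : Measurable (permMap π π') := by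
  unfold permMap R1 R2 R; fun_prop

lemma meas_abs_mem {X : Type*} [MeasurableSpace X] {g : X → ℝ} (hg : Measurable g)
    {B : Set ℝ} (hB : MeasurableSet B) : MeasurableSet {ω | |g ω| ∈ B} :=
  (show Measurable (fun ω => |g ω|) by fun_prop) hB

lemma meas_E1 (n : ℕ) {B : Set ℝ} (hB : MeasurableSet B) : MeasurableSet (E1 n B) := by
  unfold E1
  simp only [Set.setOf_forall]
  exact MeasurableSet.iInter fun l => MeasurableSet.iInter fun l' => MeasurableSet.iInter fun _ =>
    MeasurableSet.iInter fun _ => MeasurableSet.iInter fun _ => meas_abs_mem (meas_R1 l l') hB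

lemma meas_E2 (n : ℕ) {B : Set ℝ} (hB : MeasurableSet B) : MeasurableSet (E2 n B) := by
  unfold E2
  simp only [Set.setOf_forall]
  exact MeasurableSet.iInter fun l => MeasurableSet.iInter fun l' => MeasurableSet.iInter fun _ =>
    MeasurableSet.iInter fun _ => MeasurableSet.iInter fun _ => meas_abs_mem (meas_R2 l l') hB

lemma meas_Dev (n k : ℕ) {A A1 A2 : Set ℝ} (hA : MeasurableSet A) (hA1 : MeasurableSet A1)
    (hA2 : MeasurableSet A2) : MeasurableSet (Dev n k A A1 A2) :=
  ((meas_R 0 k hA).inter (meas_E1 _ hA1)).inter (meas_E2 _ hA2)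

lemma meas_Fev (k m : ℕ) {A2 : Set ℝ} (hA2 : MeasurableSet A2) : MeasurableSet (Fev k m A2) :=
  (meas_abs_mem (meas_R2 k m) hA2).compl

lemma swap_finite (a b : ℕ) : {x | Equiv.swap a b x ≠ x}.Finite := by
  refine (Set.toFinite {a, b}).subset fun x hx => ?_
  by_contra h
  simp only [Set.mem_insert_iff, Set.mem_singleton_iff, not_or] at h
  exact hx (Equiv.swap_apply_of_ne_of_ne h.1 h.2)

lemma exch_swap {μ : Measure OA} (h : Setup μ) (a b : ℕ) {S : Set OA} (hS : MeasurableSet S) :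
    μ.real (permMap 1 (Equiv.swap a b) ⁻¹' S) = μ.real S := by
  have h1 := h.exch 1 (Equiv.swap a b) (by simp) (swap_finite a b)
  conv_rhs => rw [← h1]
  rw [measureReal_def, measureReal_def, Measure.map_apply (meas_perm _ _) hS]

lemma E2_swap {n a b : ℕ} {B : Set ℝ} (ha : a < n ↔ b < n) (ω : OA) :
    permMap 1 (Equiv.swap a b) ω ∈ E2 n B ↔ ω ∈ E2 n B := by
  have hs : ∀ l, l < n → Equiv.swap a b l < n := by
    intro l hl
    rw [Equiv.swap_apply_def]; split_ifs <;> grind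
  constructor
  · intro h l l' hl hl' hne
    have := h (Equiv.swap a b l) (Equiv.swap a b l') (hs _ hl) (hs _ hl')
      (fun e => hne ((Equiv.swap a b).injective e))
    simpa [permMap, R2] using this
  · intro h l l' hl hl' hne
    exact h (Equiv.swap a b l) (Equiv.swap a b l') (hs _ hl) (hs _ hl')
      (fun e => hne ((Equiv.swap a b).injective e))

lemma Dev_swap {n k a b : ℕ} {A A1 A2 : Set ℝ} (ha : a < n ↔ b < n) (ω : OA) :
    permMap 1 (Equiv.swap a b) ω ∈ Dev n k A A1 A2 ↔
      ω ∈ Dev n (Equiv.swap a b k) A A1 A2 := by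
  have h1 : permMap 1 (Equiv.swap a b) ω ∈ E1 (n + 1) A1 ↔ ω ∈ E1 (n + 1) A1 := Iff.rfl
  have h2 : permMap 1 (Equiv.swap a b) ω ∈ {ω : OA | R ω 0 k ∈ A} ↔
    ω ∈ {ω : OA | R ω 0 (Equiv.swap a b k) ∈ A} := Iff.rfl
  simp only [Dev, Set.mem_inter_iff, h1, h2, E2_swap ha]

lemma Fev_swap {k m a b : ℕ} {A2 : Set ℝ} (ω : OA) :
    permMap 1 (Equiv.swap a b) ω ∈ Fev k m A2 ↔
      ω ∈ Fev (Equiv.swap a b k) (Equiv.swap a b m) A2 := Iff.rfl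

/-- The set of finite arrays corresponding to `Dev`. -/
def Tset (n : ℕ) (k : Fin (n + 1)) (A A1 A2 : Set ℝ) :
    Set ((Fin (n+1) → Fin (n+1) → ℝ) × (Fin (n+1) → Fin (n+1) → ℝ) ×
      (Fin (n+1) → Fin (n+1) → ℝ)) :=
  {v | v.2.2 0 k ∈ A} ∩ {v | ∀ l l' : Fin (n+1), l ≠ l' → |v.1 l l'| ∈ A1} ∩
    {v | ∀ l l' : Fin (n+1), l.val < n → l'.val < n → l ≠ l' → |v.2.1 l l'| ∈ A2}

lemma meas_Tset (n : ℕ) (k : Fin (n + 1)) {A A1 A2 : Set ℝ} (hA : MeasurableSet A)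
    (hA1 : MeasurableSet A1) (hA2 : MeasurableSet A2) : MeasurableSet (Tset n k A A1 A2) := by
  refine (MeasurableSet.inter ?_ ?_).inter ?_
  · exact (show Measurable (fun v : (Fin (n+1) → Fin (n+1) → ℝ) × (Fin (n+1) → Fin (n+1) → ℝ) ×
      (Fin (n+1) → Fin (n+1) → ℝ) => v.2.2 0 k) by fun_prop) hA
  · simp only [Set.setOf_forall]
    exact MeasurableSet.iInter fun l => MeasurableSet.iInter fun l' =>
      MeasurableSet.iInter fun _ => meas_abs_mem (by fun_prop) hA1
  · simp only [Set.setOf_forall]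
    exact MeasurableSet.iInter fun l => MeasurableSet.iInter fun l' => MeasurableSet.iInter fun _ =>
      MeasurableSet.iInter fun _ => MeasurableSet.iInter fun _ => meas_abs_mem (by fun_prop) hA2

lemma fRep_Tset (n : ℕ) (k : Fin (n + 1)) (A A1 A2 : Set ℝ) (ω : OA) :
    fRep (n + 1) ((Tset n k A A1 A2).indicator 1) ω = (Dev n k A A1 A2).indicator 1 ω := by
  have : ((fun l l' => R1 ω l.val l'.val, fun l l' => R2 ω l.val l'.val,
     fun l l' => R ω l.val l'.val) : (Fin (n+1) → Fin (n+1) → ℝ) × (Fin (n+1) → Fin (n+1) → ℝ) ×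
      (Fin (n+1) → Fin (n+1) → ℝ)) ∈ Tset n k A A1 A2 ↔ ω ∈ Dev n k A A1 A2 := by
    simp only [Tset, Dev, E1, E2, Set.mem_inter_iff, Set.mem_setOf_eq]
    refine and_congr (and_congr Iff.rfl ⟨fun h l l' hl hl' hne => ?_, fun h l l' hne => ?_⟩)
      ⟨fun h l l' hl hl' hne => ?_, fun h l l' hl hl' hne => ?_⟩
    · exact h ⟨l, hl⟩ ⟨l', hl'⟩ (by simpa using hne)
    · exact h l l' l.2 l'.2 (fun e => hne (Fin.ext e))
    · exact h ⟨l, by omega⟩ ⟨l', by omega⟩ hl hl' (by simpa using hne)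
    · exact h l l' hl hl' (fun e => hne (Fin.ext e))
  unfold fRep
  by_cases h : ω ∈ Dev n k A A1 A2
  · rw [Set.indicator_of_mem h, Set.indicator_of_mem (this.2 h)]; rfl
  · rw [Set.indicator_of_notMem h, Set.indicator_of_notMem (fun h' => h (this.1 h'))]

lemma key {μ : Measure OA} (hsetup : Setup μ) (hGG : GG2 μ)
    (n : ℕ) (hn : 1 ≤ n) {A A1 A2 : Set ℝ}
    (hA : MeasurableSet A) (hA1 : MeasurableSet A1) (hA2 : MeasurableSet A2)
    (k : ℕ) (hk : k < n) :
    n * μ.real (Dev n k A A1 A2 ∩ Fev 0 n A2) =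
      μ.real (Dev n k A A1 A2) * μ.real (Fev 0 1 A2) := by
  have hprob := hsetup.prob
  have hD := meas_Dev n k hA hA1 hA2
  have hG := hGG (n + 1) (by omega) ((Tset n ⟨k, by omega⟩ A A1 A2).indicator 1)
    (measurable_one.indicator (meas_Tset n _ hA hA1 hA2))
    ⟨1, fun v => by
      by_cases h : v ∈ Tset n ⟨k, by omega⟩ A A1 A2 <;> simp [h]⟩
    ({x : ℝ | |x| ∉ A2}.indicator 1)
    (measurable_one.indicator (meas_abs_mem measurable_id hA2).compl)
    ⟨1, fun v => by
      by_cases h : v ∈ {x : ℝ | |x| ∉ A2} <;> simp only [h, Set.indicator_of_mem,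
        Set.indicator_of_notMem, not_false_eq_true] <;> simp⟩
    (fun x => by
      have e : |(-x)| = |x| := abs_neg x
      by_cases h : |x| ∈ A2 <;> simp [Set.indicator, e, h])
  have hψ : ∀ m, ∀ ω : OA, ({x : ℝ | |x| ∉ A2}.indicator 1 (R2 ω 0 m) : ℝ)
      = (Fev 0 m A2).indicator 1 ω := fun m ω => rfl
  have hmul : ∀ m, ∀ ω : OA, ((Dev n k A A1 A2).indicator 1 ω * (Fev 0 m A2).indicator 1 ω : ℝ)
      = (Dev n k A A1 A2 ∩ Fev 0 m A2).indicator 1 ω := fun m ω => by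
    rw [Set.inter_indicator_one]; rfl
  simp only [fRep_Tset, hψ, hmul] at hG
  rw [integral_indicator_one hD, integral_indicator_one (meas_Fev 0 1 hA2),
    integral_indicator_one (hD.inter (meas_Fev 0 _ hA2))] at hG
  simp only [integral_indicator_one (hD.inter (meas_Fev 0 _ hA2))] at hG
  rw [Finset.sum_Ico_succ_top hn, Finset.sum_eq_zero] at hG
  · have hx : μ.real (Dev n k A A1 A2 ∩ Fev 0 (n + 1) A2)
        = μ.real (Dev n k A A1 A2 ∩ Fev 0 n A2) := by
      rw [← exch_swap hsetup n (n + 1) (hD.inter (meas_Fev 0 n hA2))]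
      congr 1
      ext ω
      rw [Set.mem_preimage, Set.mem_inter_iff, Set.mem_inter_iff, Dev_swap (by omega), Fev_swap,
        Equiv.swap_apply_of_ne_of_ne (x := k) (by omega) (by omega),
        Equiv.swap_apply_of_ne_of_ne (x := 0) (by omega) (by omega), Equiv.swap_apply_left]
    rw [hx] at hG
    push_cast at hG
    field_simp at hG
    linarith
  · intro l hl
    rw [Finset.mem_Ico] at hl
    have : Dev n k A A1 A2 ∩ Fev 0 l A2 = ∅ := by
      ext ω
      simp only [Set.mem_inter_iff, Set.mem_empty_iff_false, iff_false, not_and]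
      intro h h'
      exact h' (h.2 0 l (by omega) hl.2 (by omega))
    rw [this]; simp

lemma key2 {μ : Measure OA} (hsetup : Setup μ) (hGG : GG2 μ)
    (n : ℕ) (hn : 1 ≤ n) {A A1 A2 : Set ℝ}
    (hA : MeasurableSet A) (hA1 : MeasurableSet A1) (hA2 : MeasurableSet A2)
    (k : ℕ) (hk : k < n) :
    n * μ.real (Cev n A A1 A2 ∩ Fev k n A2) =
      μ.real (Cev n A A1 A2) * μ.real (Fev 0 1 A2) := by
  have h := key hsetup hGG n hn hA hA1 hA2 k hk
  have hD := meas_Dev n k hA hA1 hA2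
  rw [← exch_swap hsetup 0 k (hD.inter (meas_Fev 0 n hA2)), ← exch_swap hsetup 0 k hD] at h
  have e1 : permMap 1 (Equiv.swap 0 k) ⁻¹' Dev n k A A1 A2 = Cev n A A1 A2 := by
    ext ω
    rw [Set.mem_preimage, Dev_swap (by omega), Equiv.swap_apply_right]; rfl
  have e2 : permMap 1 (Equiv.swap 0 k) ⁻¹' Fev 0 n A2 = Fev k n A2 := by
    ext ω
    rw [Set.mem_preimage, Fev_swap, Equiv.swap_apply_left,
      Equiv.swap_apply_of_ne_of_ne (x := n) (by omega) (by omega)]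
  rwa [Set.preimage_inter, e1, e2] at h

end OverlapArray

/-- In the overlap array setup, if `μ` satisfies the Ghirlanda–Guerra
identities for system 2, then for every `n ≥ 1` and all Borel sets `A ⊆ [-1,1]`,
`A₁, A₂ ⊆ [0,1]`, one has `μ(B_{n+1}) ≥ μ₂(A₂) · μ(C_n)`. -/
theorem statement_9 (μ : Measure OA) (hsetup : Setup μ) (hGG : GG2 μ)
    (n : ℕ) (hn : 1 ≤ n) (A A1 A2 : Set ℝ)
    (hA : MeasurableSet A) (hA1 : MeasurableSet A1) (hA2 : MeasurableSet A2)
    (hAsub : A ⊆ Set.Icc (-1) 1) (hA1sub : A1 ⊆ Set.Icc 0 1) (hA2sub : A2 ⊆ Set.Icc 0 1) :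
    μ (Bev (n + 1) A A1 A2) ≥ μ {ω | |R2 ω 0 1| ∈ A2} * μ (Cev n A A1 A2) := by
  have hprob := hsetup.prob
  have hsub : ∀ᵐ ω ∂μ, ω ∈ Cev n A A1 A2 →
      ω ∈ Bev (n + 1) A A1 A2 ∪ ⋃ k ∈ Finset.range n, (Cev n A A1 A2 ∩ Fev k n A2) := by
    filter_upwards [hsetup.symm] with ω hs hω
    by_cases h : ∃ k < n, ω ∈ Fev k n A2
    · obtain ⟨k, hk, h⟩ := h
      right
      simp only [Set.mem_iUnion]
      exact ⟨k, Finset.mem_range.2 hk, hω, h⟩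
    · left
      have h' : ∀ k < n, |R2 ω k n| ∈ A2 := fun k hk => by
        by_contra hc
        exact h ⟨k, hk, hc⟩
      refine ⟨hω.1, fun l l' hl hl' hne => ?_⟩
      rcases Nat.lt_succ_iff_lt_or_eq.1 hl with hl | hl <;>
        rcases Nat.lt_succ_iff_lt_or_eq.1 hl' with hl' | hl'
      · exact hω.2 l l' hl hl' hne
      · subst hl'; exact h' l hl
      · subst hl; rw [(hs l l').2]; exact h' l' hl'
      · omega
  have h1 : μ.real (Cev n A A1 A2) ≤ μ.real (Bev (n + 1) A A1 A2) +
      ∑ k ∈ Finset.range n, μ.real (Cev n A A1 A2 ∩ Fev k n A2) := by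
    refine (ENNReal.toReal_mono (measure_ne_top _ _) (measure_mono_ae hsub)).trans ?_
    refine (measureReal_union_le _ _).trans ?_
    gcongr
    exact measureReal_biUnion_finset_le _ _
  have hn0 : (n : ℝ) ≠ 0 := by positivity
  have h2 : ∑ k ∈ Finset.range n, μ.real (Cev n A A1 A2 ∩ Fev k n A2) =
      μ.real (Cev n A A1 A2) * μ.real (Fev 0 1 A2) := by
    rw [Finset.sum_congr rfl (g := fun _ => μ.real (Cev n A A1 A2) * μ.real (Fev 0 1 A2) / n)]
    · rw [Finset.sum_const, Finset.card_range, nsmul_eq_mul]; field_simp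
    · intro k hk
      rw [← key2 hsetup hGG n hn hA hA1 hA2 k (Finset.mem_range.1 hk)]; field_simp
  have h3 : μ.real (Fev 0 1 A2) = 1 - μ.real {ω | |R2 ω 0 1| ∈ A2} :=
    probReal_compl_eq_one_sub (meas_abs_mem (meas_R2 0 1) hA2)
  rw [h2, h3] at h1
  rw [ge_iff_le, ← ENNReal.toReal_le_toReal (by finiteness) (by finiteness), ENNReal.toReal_mul]
  simp only [← measureReal_def]
  linarith
end

section
/- In the overlap array setup, let p ≥ 1 be an odd integer, and suppose μ satisfies the Ψ-identities for system 1 and the Ψ-identities for system 2 with the function ψ(x) = x^p. Then μ( R_{l,l'} = R_{1,1} for all l, l' ≥ 1 ) = 1. -/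
open MeasureTheory

namespace OverlapArray

/-- The Ψ-identities for system 1 with function `ψ`: for every `n ≥ 1` and every bounded
measurable function `f` of the overlaps on `n` replicas,
`E[f·ψ(R_{1,n+1})] = (1/n) ∑_{l=1}^n E[f·ψ(R_{1,l})]`
(replicas are indexed from `0` here). -/
def Psi1Id (μ : MeasureTheory.Measure OA) (ψ : ℝ → ℝ) : Prop :=
  ∀ n : ℕ, 1 ≤ n →
  ∀ f : ((Fin n → Fin n → ℝ) × (Fin n → Fin n → ℝ) × (Fin n → Fin n → ℝ)) → ℝ,
    Measurable f → (∃ C, ∀ v, |f v| ≤ C) →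
    ∫ ω, fRep n f ω * ψ (R ω 0 n) ∂μ
      = (1 / n) * ∑ l ∈ Finset.range n, ∫ ω, fRep n f ω * ψ (R ω 0 l) ∂μ

/-- The Ψ-identities for system 2 with function `ψ`: for every `n ≥ 1` and every bounded
measurable function `f` of the overlaps on `n` replicas,
`E[f·ψ(R_{n+1,1})] = (1/n) ∑_{l=1}^n E[f·ψ(R_{l,1})]`. -/
def Psi2Id (μ : MeasureTheory.Measure OA) (ψ : ℝ → ℝ) : Prop :=
  ∀ n : ℕ, 1 ≤ n →
  ∀ f : ((Fin n → Fin n → ℝ) × (Fin n → Fin n → ℝ) × (Fin n → Fin n → ℝ)) → ℝ,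
    Measurable f → (∃ C, ∀ v, |f v| ≤ C) →
    ∫ ω, fRep n f ω * ψ (R ω n 0) ∂μ
      = (1 / n) * ∑ l ∈ Finset.range n, ∫ ω, fRep n f ω * ψ (R ω l 0) ∂μ

end OverlapArray

open OverlapArray

theorem aux_ae_eq {μ : Measure OA} [IsProbabilityMeasure μ] {Y Z : OA → ℝ}
    (hY : Measurable Y) (hZ : Measurable Z)
    (bY : ∀ᵐ ω ∂μ, |Y ω| ≤ 1) (bZ : ∀ᵐ ω ∂μ, |Z ω| ≤ 1)
    (hYZ : ∫ ω, Y ω * Z ω ∂μ = ∫ ω, Y ω * Y ω ∂μ)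
    (hZZ : ∫ ω, Z ω * Z ω ∂μ = ∫ ω, Y ω * Y ω ∂μ) : ∀ᵐ ω ∂μ, Y ω = Z ω := by
  have key : ∀ {U V : OA → ℝ}, Measurable U → Measurable V → (∀ᵐ ω ∂μ, |U ω| ≤ 1) →
      (∀ᵐ ω ∂μ, |V ω| ≤ 1) → Integrable (fun ω => U ω * V ω) μ := by
    intro U V hU hV bU bV
    refine Integrable.of_bound (hU.mul hV).aestronglyMeasurable 1 ?_
    filter_upwards [bU, bV] with ω h h'
    rw [Real.norm_eq_abs, abs_mul]
    exact mul_le_one₀ h (abs_nonneg _) h'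
  have iYY := key hY hY bY bY
  have iYZ := key hY hZ bY bZ
  have iZZ := key hZ hZ bZ bZ
  have hexp : (fun ω => (Y ω - Z ω) ^ 2)
      = fun ω => (Y ω * Y ω + Z ω * Z ω) - 2 * (Y ω * Z ω) := by
    funext ω; ring
  have hint : Integrable (fun ω => (Y ω - Z ω) ^ 2) μ := by
    rw [hexp]; exact (iYY.add iZZ).sub (iYZ.const_mul 2)
  have h0 : ∫ ω, (Y ω - Z ω) ^ 2 ∂μ = 0 := by
    rw [hexp, integral_sub (f := fun ω => Y ω * Y ω + Z ω * Z ω) (iYY.add iZZ) (iYZ.const_mul 2), integral_add iYY iZZ,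
      integral_const_mul, hYZ, hZZ]
    ring
  have h := (integral_eq_zero_iff_of_nonneg (fun ω => sq_nonneg _) hint).1 h0
  filter_upwards [h] with ω hω
  have h3 : (Y ω - Z ω) ^ 2 = 0 := hω
  exact sub_eq_zero.1 (pow_eq_zero_iff (two_ne_zero)|>.1 h3)

theorem measurable_R_entry (l l' : ℕ) : Measurable (fun ω : OA => R ω l l') := by
  unfold R; fun_prop

theorem measurable_permMap (π π' : Equiv.Perm ℕ) : Measurable (permMap π π') := by
  unfold permMap R R1 R2; fun_prop

theorem finite_swap (a b : ℕ) : {x | Equiv.swap a b x ≠ x}.Finite := by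
  refine (Set.toFinite {a, b}).subset ?_
  intro x hx
  by_contra h
  simp only [Set.mem_insert_iff, Set.mem_singleton_iff, not_or] at h
  exact hx (Equiv.swap_apply_of_ne_of_ne h.1 h.2)

theorem aux_exch {μ : Measure OA} (hs : Setup μ) (a b c d : ℕ) {P : OA → Prop}
    (h : ∀ᵐ ω ∂μ, P ω) :
    ∀ᵐ ω ∂μ, P (permMap (Equiv.swap a b) (Equiv.swap c d) ω) := by
  rw [← hs.exch _ _ (finite_swap a b) (finite_swap c d)] at h
  exact ae_of_ae_map (measurable_permMap _ _).aemeasurable h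

theorem aux_exch_int {μ : Measure OA} (hs : Setup μ) (a b c d : ℕ) {F : OA → ℝ}
    (h : Measurable F) :
    ∫ ω, F ω ∂μ = ∫ ω, F (permMap (Equiv.swap a b) (Equiv.swap c d) ω) ∂μ := by
  conv_lhs => rw [← hs.exch _ _ (finite_swap a b) (finite_swap c d)]
  exact integral_map (measurable_permMap _ _).aemeasurable h.aestronglyMeasurable

/-- Truncation to `[-1,1]`. -/
noncomputable def clamp (x : ℝ) : ℝ := max (-1) (min 1 x)

theorem clamp_abs (x : ℝ) : |clamp x| ≤ 1 := by
  unfold clamp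
  rw [abs_le]
  exact ⟨le_max_left _ _, max_le (by norm_num) (min_le_left _ _)⟩

theorem clamp_eq {x : ℝ} (h : |x| ≤ 1) : clamp x = x := by
  rw [abs_le] at h
  unfold clamp
  rw [min_eq_right h.2, max_eq_right h.1]

/-- The test function on one replica. -/
noncomputable def tf (p : ℕ)
    (v : (Fin 1 → Fin 1 → ℝ) × (Fin 1 → Fin 1 → ℝ) × (Fin 1 → Fin 1 → ℝ)) : ℝ :=
  (clamp (v.2.2 0 0)) ^ p

theorem tf_meas (p : ℕ) : Measurable (tf p) := by
  unfold tf clamp; fun_prop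

theorem tf_bdd (p : ℕ) : ∃ C, ∀ v, |tf p v| ≤ C :=
  ⟨1, fun v => by
    unfold tf; rw [abs_pow]; exact pow_le_one₀ (abs_nonneg _) (clamp_abs _)⟩

theorem tf_int {μ : Measure OA} (hs : Setup μ) (p : ℕ) (G : OA → ℝ) :
    ∫ ω, fRep 1 (tf p) ω * G ω ∂μ = ∫ ω, R ω 0 0 ^ p * G ω ∂μ := by
  refine integral_congr_ae ?_
  filter_upwards [hs.bounded] with ω hω
  have : fRep 1 (tf p) ω = R ω 0 0 ^ p := by
    simp [fRep, tf, clamp_eq (hω 0 0).2.2]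
  rw [this]

theorem bdd_pow {μ : Measure OA} (hs : Setup μ) (p l l' : ℕ) :
    ∀ᵐ ω ∂μ, |R ω l l' ^ p| ≤ 1 := by
  filter_upwards [hs.bounded] with ω hω
  have hb := (hω l l').2.2
  rw [abs_pow]
  exact pow_le_one₀ (abs_nonneg _) hb

/-- In the overlap array setup, if `p ≥ 1` is odd and `μ` satisfies the
Ψ-identities for both systems with `ψ(x) = x^p`, then
`μ(R_{l,l'} = R_{1,1} for all l,l') = 1`. -/
theorem statement_16 (μ : MeasureTheory.Measure OA) (hsetup : Setup μ)
    (p : ℕ) (hp : 1 ≤ p) (hpodd : Odd p)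
    (h1 : Psi1Id μ (fun x => x ^ p)) (h2 : Psi2Id μ (fun x => x ^ p)) :
    μ {ω | ∀ l l', R ω l l' = R ω 0 0} = 1 := by
  have hprob := hsetup.prob
  have m (l l' : ℕ) : Measurable (fun ω : OA => R ω l l' ^ p) :=
    (measurable_R_entry l l').pow_const p
  have e1 : ∀ᵐ ω ∂μ, R ω 0 0 = R ω 0 1 := by
    have h := h1 1 le_rfl (tf p) (tf_meas p) (tf_bdd p)
    simp only [Finset.range_one, Finset.sum_singleton, Nat.cast_one, div_one, one_mul,
      tf_int hsetup] at h
    have hz := aux_exch_int hsetup 0 0 0 1 ((m 0 1).mul (m 0 1))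
    simp only [permMap, R, Equiv.swap_self, Equiv.refl_apply] at hz
    have := aux_ae_eq (m 0 0) (m 0 1) (bdd_pow hsetup p 0 0) (bdd_pow hsetup p 0 1) h hz
    filter_upwards [this] with ω hω using hpodd.strictMono_pow.injective hω
  have e2 : ∀ᵐ ω ∂μ, R ω 0 0 = R ω 1 0 := by
    have h := h2 1 le_rfl (tf p) (tf_meas p) (tf_bdd p)
    simp only [Finset.range_one, Finset.sum_singleton, Nat.cast_one, div_one, one_mul,
      tf_int hsetup] at h
    have hz := aux_exch_int hsetup 0 1 0 0 ((m 1 0).mul (m 1 0))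
    simp only [permMap, R, Equiv.swap_self, Equiv.refl_apply] at hz
    have := aux_ae_eq (m 0 0) (m 1 0) (bdd_pow hsetup p 0 0) (bdd_pow hsetup p 1 0) h hz
    filter_upwards [this] with ω hω using hpodd.strictMono_pow.injective hω
  have c1 : ∀ l l', ∀ᵐ ω ∂μ, R ω l 0 = R ω l l' := by
    intro l l'
    by_cases hl : l' = 0
    · subst hl; exact Filter.Eventually.of_forall fun _ => rfl
    have h := aux_exch hsetup 0 l 1 l' e1
    have h0 : Equiv.swap 1 l' 0 = 0 :=
      Equiv.swap_apply_of_ne_of_ne (by norm_num) (Ne.symm hl)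
    filter_upwards [h] with ω hω
    simpa [permMap, R, h0] using hω
  have c2 : ∀ l, ∀ᵐ ω ∂μ, R ω 0 0 = R ω l 0 := by
    intro l
    by_cases hl : l = 0
    · subst hl; exact Filter.Eventually.of_forall fun _ => rfl
    have h := aux_exch hsetup 1 l 0 0 e2
    have h0 : Equiv.swap 1 l 0 = 0 :=
      Equiv.swap_apply_of_ne_of_ne (by norm_num) (Ne.symm hl)
    filter_upwards [h] with ω hω
    simpa [permMap, R, h0] using hω
  have hall : ∀ᵐ ω ∂μ, ∀ l l', R ω l l' = R ω 0 0 := by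
    rw [ae_all_iff]; intro l
    rw [ae_all_iff]; intro l'
    filter_upwards [c1 l l', c2 l] with ω ha hb
    rw [← ha, ← hb]
  have hms : μ {ω | ∀ l l', R ω l l' = R ω 0 0} = μ Set.univ :=
    measure_congr (by filter_upwards [hall] with ω hω; exact propext (iff_true_intro hω))
  rw [hms]; exact measure_univ
end
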